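/- Let I be a dyadic interval, let T be a collection of N pairwise disjoint tiles t with I_t = I, and let H_I be the linear span of the Walsh wave packets {w_t : t ∈ T} inside L²(I). Then there is an absolute constant c such that for every 2 ≤ p′ < ∞ and every v ∈ H_I, ‖v‖_{L^{p′}(I, dx/|I|)} ≤ c N^{1/2 − 1/p′} ‖v‖_{L²(I, dx/|I|)}. -/

import Mathlib

/- Walsh wave packet analysis: bitiles, wave packets, model sums. -/

open MeasureTheory

noncomputable section

/-- The `k`-th Rademacher function `r_k(x) = sign (sin (2^{k+1} π x))`. -/
def rademacher (k : ℕ) (x : ℝ) : ℝ :=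
  Real.sign (Real.sin (2 ^ (k + 1) * Real.pi * x))

/-- The `n`-th Walsh function `W_n = ∏_k r_k^{ε_k}` where `n = Σ_k ε_k 2^k`. -/
def walsh (n : ℕ) (x : ℝ) : ℝ :=
  ∏ k ∈ Finset.range n, if n.testBit k then rademacher k x else 1

/-- The `n`-th Walsh character on `𝕋 = [0,1)`, extended by zero off `[0,1)`. -/
def walshChar (n : ℕ) (x : ℝ) : ℝ :=
  if x ∈ Set.Ico (0 : ℝ) 1 then walsh n x else 0


/-- A tile `t = I_t × ω_t` of area one: `I_t = [2^k n, 2^k (n+1))` and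
`ω_t = [2^{-k} m, 2^{-k} (m+1))`. -/
structure Tile where
  k : ℤ
  n : ℕ
  m : ℕ
deriving DecidableEq

namespace Tile

/-- `|I_t|`. -/
def len (t : Tile) : ℝ := (2 : ℝ) ^ t.k

/-- `inf I_t`. -/
def left (t : Tile) : ℝ := (2 : ℝ) ^ t.k * t.n

/-- The time interval `I_t`. -/
def Iset (t : Tile) : Set ℝ := Set.Ico t.left (t.left + t.len)

/-- The frequency interval `ω_t`. -/
def ωset (t : Tile) : Set ℝ :=
  Set.Ico ((2 : ℝ) ^ (-t.k) * t.m) ((2 : ℝ) ^ (-t.k) * (t.m + 1))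

/-- The tile as a rectangle `I_t × ω_t ⊆ ℝ × ℝ`. -/
def rect (t : Tile) : Set (ℝ × ℝ) := t.Iset ×ˢ t.ωset

/-- The Walsh wave packet
`w_t(x) = |I_t|^{-1/2} W_{n_t}((x - inf I_t)/|I_t|)`, `n_t = |I_t| inf ω_t = m`. -/
def wp (t : Tile) (x : ℝ) : ℝ :=
  (Real.sqrt t.len)⁻¹ * walshChar t.m ((x - t.left) / t.len)

end Tile

end

theorem abs_rademacher_le_one (k : ℕ) (x : ℝ) : |rademacher k x| ≤ 1 := by
  unfold rademacher
  rcases Real.sign_apply_eq (Real.sin (2 ^ (k + 1) * Real.pi * x)) with h | h | h <;> simp [h]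

theorem rademacher_mul_self_of_irrational (k : ℕ) {x : ℝ} (hx : Irrational x) :
    rademacher k x * rademacher k x = 1 := by
  have hne : Real.sin (2 ^ (k + 1) * Real.pi * x) ≠ 0 := by
    rw [Real.sin_ne_zero_iff]
    intro z hz
    refine hx ⟨(z : ℚ) / 2 ^ (k + 1), ?_⟩
    have hz' : (z : ℝ) = 2 ^ (k + 1) * x :=
      mul_right_cancel₀ Real.pi_ne_zero (by rw [hz]; ring)
    push_cast
    rw [hz']
    field_simp
  unfold rademacher
  rcases Real.sign_apply_eq_of_ne_zero _ hne with h | h <;> simp [h]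

theorem rademacher_add_half_period (k : ℕ) (x : ℝ) :
    rademacher k (x + (2 ^ (k + 1))⁻¹) = -rademacher k x := by
  unfold rademacher
  rw [show (2 : ℝ) ^ (k + 1) * Real.pi * (x + (2 ^ (k + 1))⁻¹)
    = 2 ^ (k + 1) * Real.pi * x + Real.pi by field_simp, Real.sin_add_pi, Real.sign_neg]

theorem rademacher_periodic {j k : ℕ} (h : j ≤ k) :
    Function.Periodic (rademacher k) (2 ^ j)⁻¹ := by
  intro x
  obtain ⟨d, rfl⟩ := Nat.exists_eq_add_of_le h
  unfold rademacher
  rw [show (2 : ℝ) ^ (j + d + 1) * Real.pi * (x + (2 ^ j)⁻¹)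
    = 2 ^ (j + d + 1) * Real.pi * x + ((2 ^ d : ℕ) : ℝ) * (2 * Real.pi) by
      push_cast; rw [pow_succ, pow_add]; field_simp, Real.sin_add_nat_mul_two_pi]

theorem measurable_rademacher (k : ℕ) : Measurable (rademacher k) := by
  have h : Measurable Real.sign := by
    unfold Real.sign
    exact Measurable.ite measurableSet_Iio measurable_const
      (Measurable.ite measurableSet_Ioi measurable_const measurable_const)
  unfold rademacher
  fun_prop

theorem walsh_eq_prod_range {n M : ℕ} (h : n ≤ M) (x : ℝ) :
    walsh n x = ∏ k ∈ Finset.range M, if n.testBit k then rademacher k x else 1 := by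
  refine Finset.prod_subset (Finset.range_mono h) fun k _ hk => if_neg fun hb => hk ?_
  exact Finset.mem_range.2 (Nat.lt_two_pow_self.trans_le (Nat.ge_two_pow_of_testBit hb))

theorem abs_walsh_le_one (n : ℕ) (x : ℝ) : |walsh n x| ≤ 1 := by
  unfold walsh
  rw [Finset.abs_prod]
  refine Finset.prod_le_one (fun _ _ => abs_nonneg _) fun k _ => ?_
  split_ifs
  · exact abs_rademacher_le_one k x
  · simp

theorem walsh_mul_self_of_irrational (n : ℕ) {x : ℝ} (hx : Irrational x) :
    walsh n x * walsh n x = 1 := by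
  unfold walsh
  rw [← Finset.prod_mul_distrib]
  refine Finset.prod_eq_one fun k _ => ?_
  split_ifs
  · exact rademacher_mul_self_of_irrational k hx
  · simp

theorem walsh_periodic (n : ℕ) : Function.Periodic (walsh n) 1 := by
  intro x
  refine Finset.prod_congr rfl fun k _ => ?_
  have h := rademacher_periodic k.zero_le x
  rw [pow_zero, inv_one] at h
  rw [h]

theorem measurable_walsh (n : ℕ) : Measurable (walsh n) := by
  refine Finset.measurable_fun_prod _ fun k _ => ?_
  split_ifs
  · exact measurable_rademacher k
  · exact measurable_const

/-- If `j` is the lowest binary digit at which `m` and `n` differ, translation by `2^{-(j+1)}`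
flips the sign of `W_m W_n`. -/
theorem walsh_mul_walsh_add_half_period {m n j : ℕ} (hj : m.testBit j ≠ n.testBit j)
    (hlt : ∀ k < j, m.testBit k = n.testBit k) {x : ℝ} (hx : Irrational x) :
    walsh m (x + (2 ^ (j + 1))⁻¹) * walsh n (x + (2 ^ (j + 1))⁻¹) = -(walsh m x * walsh n x) := by
  have hx' : Irrational (x + (2 ^ (j + 1))⁻¹) := by
    have := hx.add_ratCast ((2 ^ (j + 1))⁻¹ : ℚ)
    push_cast at this
    exact this
  set M := max (j + 1) (max m n)
  have hm : m ≤ M := by omega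
  have hn : n ≤ M := by omega
  have hjM : j ∈ Finset.range M := Finset.mem_range.2 (by omega)
  simp only [walsh_eq_prod_range hm, walsh_eq_prod_range hn, ← Finset.prod_mul_distrib]
  have key : ∀ k ∈ Finset.range M,
      ((if m.testBit k then rademacher k (x + (2 ^ (j + 1))⁻¹) else 1) *
        (if n.testBit k then rademacher k (x + (2 ^ (j + 1))⁻¹) else 1)) =
      (if k = j then -1 else 1) * ((if m.testBit k then rademacher k x else 1) *
        (if n.testBit k then rademacher k x else 1)) := by
    intro k _
    rcases lt_trichotomy k j with h | rfl | h
    · rw [hlt k h, if_neg h.ne]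
      split_ifs
      · rw [rademacher_mul_self_of_irrational k hx, rademacher_mul_self_of_irrational k hx',
          one_mul]
      · simp
    · rw [rademacher_add_half_period]
      cases hmk : m.testBit k <;> cases hnk : n.testBit k <;> simp_all
    · rw [rademacher_periodic (Nat.succ_le_of_lt h) x, if_neg h.ne', one_mul]
  rw [Finset.prod_congr rfl key, Finset.prod_mul_distrib, Finset.prod_ite_eq' _ j, if_pos hjM,
    neg_one_mul]

theorem ae_irrational : ∀ᵐ x : ℝ, Irrational x :=
  (Set.countable_range ((↑) : ℚ → ℝ)).ae_notMem volume

theorem integral_walsh_mul_walsh_of_ne {m n : ℕ} (h : m ≠ n) :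
    ∫ x in (0 : ℝ)..1, walsh m x * walsh n x = 0 := by
  have hex : ∃ j, m.testBit j ≠ n.testBit j := by
    by_contra! hc
    exact h (Nat.eq_of_testBit_eq hc)
  have hlt : ∀ k < Nat.find hex, m.testBit k = n.testBit k :=
    fun k hk => not_not.1 (Nat.find_min hex hk)
  set c : ℝ := (2 ^ (Nat.find hex + 1))⁻¹
  have hper : Function.Periodic (fun x => walsh m x * walsh n x) 1 :=
    (walsh_periodic m).mul (walsh_periodic n)
  have h1 : ∫ x in (0 : ℝ)..1, walsh m (x + c) * walsh n (x + c)
      = ∫ x in (0 : ℝ)..1, walsh m x * walsh n x := by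
    rw [intervalIntegral.integral_comp_add_right (fun x => walsh m x * walsh n x) c]
    simpa only [zero_add, add_comm] using hper.intervalIntegral_add_eq c 0
  have h2 : ∫ x in (0 : ℝ)..1, walsh m (x + c) * walsh n (x + c)
      = -∫ x in (0 : ℝ)..1, walsh m x * walsh n x := by
    rw [← intervalIntegral.integral_neg]
    refine intervalIntegral.integral_congr_ae ?_
    filter_upwards [ae_irrational] with x hx _
    exact walsh_mul_walsh_add_half_period (Nat.find_spec hex) hlt hx
  linarith

theorem integral_walsh_mul_self (n : ℕ) : ∫ x in (0 : ℝ)..1, walsh n x * walsh n x = 1 := by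
  have : ∫ x in (0 : ℝ)..1, walsh n x * walsh n x = ∫ _ in (0 : ℝ)..1, (1 : ℝ) := by
    refine intervalIntegral.integral_congr_ae ?_
    filter_upwards [ae_irrational] with x hx _
    exact walsh_mul_self_of_irrational n hx
  simp [this]

theorem intervalIntegrable_of_abs_le {f : ℝ → ℝ} (hf : Measurable f) {C : ℝ}
    (hC : ∀ x, |f x| ≤ C) (a b : ℝ) : IntervalIntegrable f volume a b :=
  (intervalIntegrable_const (c := C)).mono_fun hf.aestronglyMeasurable
    (Filter.Eventually.of_forall fun x => (hC x).trans (le_abs_self C))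

/-- Parseval's identity for finite Walsh sums. -/
theorem integral_sum_walsh_sq {ι : Type*} (s : Finset ι) {m : ι → ℕ} (hm : Set.InjOn m s)
    (b : ι → ℝ) :
    ∫ x in (0 : ℝ)..1, (∑ i ∈ s, b i * walsh (m i) x) ^ 2 = ∑ i ∈ s, b i ^ 2 := by
  have hint : ∀ i j, IntervalIntegrable
      (fun x => b i * walsh (m i) x * (b j * walsh (m j) x)) volume 0 1 := by
    intro i j
    refine intervalIntegrable_of_abs_le (C := |b i| * |b j|) ?_ (fun x => ?_) 0 1
    · exact ((measurable_walsh _).const_mul _).mul ((measurable_walsh _).const_mul _)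
    · rw [abs_mul, abs_mul, abs_mul]
      exact mul_le_mul (mul_le_of_le_one_right (abs_nonneg _) (abs_walsh_le_one _ _))
        (mul_le_of_le_one_right (abs_nonneg _) (abs_walsh_le_one _ _)) (by positivity)
        (abs_nonneg _)
  simp only [sq, Finset.sum_mul_sum]
  rw [intervalIntegral.integral_finsetSum fun i _ => by
    simpa only [Finset.sum_fn] using IntervalIntegrable.sum s fun j _ => hint i j]
  refine Finset.sum_congr rfl fun i hi => ?_
  rw [intervalIntegral.integral_finsetSum fun j _ => hint i j, Finset.sum_eq_single i]
  · simp_rw [mul_mul_mul_comm]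
    rw [intervalIntegral.integral_const_mul, integral_walsh_mul_self, mul_one]
  · intro j hj hji
    simp_rw [mul_mul_mul_comm]
    rw [intervalIntegral.integral_const_mul,
      integral_walsh_mul_walsh_of_ne fun h => hji (hm hj hi h.symm), mul_zero]
  · exact fun h => absurd hi h

theorem abs_sum_walsh_le {ι : Type*} (s : Finset ι) (m : ι → ℕ) (b : ι → ℝ) (x : ℝ) :
    |∑ i ∈ s, b i * walsh (m i) x| ≤ √(s.card * ∑ i ∈ s, b i ^ 2) := by
  have h1 : |∑ i ∈ s, b i * walsh (m i) x| ≤ ∑ i ∈ s, |b i| := by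
    refine (Finset.abs_sum_le_sum_abs _ _).trans (Finset.sum_le_sum fun i _ => ?_)
    rw [abs_mul]
    exact mul_le_of_le_one_right (abs_nonneg _) (abs_walsh_le_one _ _)
  refine h1.trans (Real.le_sqrt_of_sq_le ?_)
  simpa using sq_sum_le_card_mul_sum_sq (s := s) (f := fun i => |b i|)

/-- Interpolation between the `L²` norm and a uniform bound on `[0, 1]`. -/
theorem integral_abs_rpow_le {u : ℝ → ℝ} (hu : Measurable u) {C : ℝ} (hC : ∀ x, |u x| ≤ C)
    {p : ℝ} (hp : 2 ≤ p) :
    ∫ x in (0 : ℝ)..1, |u x| ^ p ≤ C ^ (p - 2) * ∫ x in (0 : ℝ)..1, u x ^ 2 := by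
  have hC0 : 0 ≤ C := (abs_nonneg _).trans (hC 0)
  rw [← intervalIntegral.integral_const_mul]
  refine intervalIntegral.integral_mono_on zero_le_one ?_ ?_ fun x _ => ?_
  · refine intervalIntegrable_of_abs_le (C := C ^ p) (by fun_prop) (fun x => ?_) 0 1
    rw [abs_of_nonneg (by positivity)]
    exact Real.rpow_le_rpow (abs_nonneg _) (hC x) (by linarith)
  · refine IntervalIntegrable.const_mul ?_ _
    refine intervalIntegrable_of_abs_le (C := C ^ 2) (by fun_prop) (fun x => ?_) 0 1
    rw [abs_pow]
    exact pow_le_pow_left₀ (abs_nonneg _) (hC x) 2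
  · calc |u x| ^ p = |u x| ^ (p - 2) * u x ^ 2 := by
          rw [← sq_abs (u x), ← Real.rpow_natCast |u x| 2,
            ← Real.rpow_add_of_nonneg (abs_nonneg _) (by linarith) (by norm_num)]
          norm_num
      _ ≤ C ^ (p - 2) * u x ^ 2 := mul_le_mul_of_nonneg_right
          (Real.rpow_le_rpow (abs_nonneg _) (hC x) (by linarith)) (sq_nonneg _)

theorem sum_walsh_Lp_estimate {ι : Type*} (s : Finset ι) {m : ι → ℕ} (hm : Set.InjOn m s)
    (b : ι → ℝ) {p : ℝ} (hp : 2 ≤ p) :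
    (∫ x in (0 : ℝ)..1, |∑ i ∈ s, b i * walsh (m i) x| ^ p) ^ (1 / p) ≤
      (s.card : ℝ) ^ ((1 : ℝ) / 2 - 1 / p) *
        (∫ x in (0 : ℝ)..1, (∑ i ∈ s, b i * walsh (m i) x) ^ 2) ^ ((1 : ℝ) / 2) := by
  have hp0 : 0 < p := by linarith
  have hmeas : Measurable fun x => ∑ i ∈ s, b i * walsh (m i) x :=
    Finset.measurable_fun_sum _ fun i _ => (measurable_walsh _).const_mul _
  have h := integral_abs_rpow_le hmeas (abs_sum_walsh_le s m b) hp
  rw [integral_sum_walsh_sq s hm b] at h ⊢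
  set B := ∑ i ∈ s, b i ^ 2
  have hB : 0 ≤ B := Finset.sum_nonneg fun i _ => sq_nonneg _
  have hN : (0 : ℝ) ≤ s.card := Nat.cast_nonneg _
  have hint : 0 ≤ ∫ x in (0 : ℝ)..1, |∑ i ∈ s, b i * walsh (m i) x| ^ p :=
    intervalIntegral.integral_nonneg zero_le_one fun x _ => by positivity
  calc _ ≤ (√(s.card * B) ^ (p - 2) * B) ^ (1 / p) :=
        Real.rpow_le_rpow hint h (by positivity)
    _ = (s.card : ℝ) ^ ((1 : ℝ) / 2 - 1 / p) *
        (B ^ ((1 : ℝ) / 2 - 1 / p) * B ^ (1 / p)) := by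
      rw [Real.sqrt_eq_rpow, ← Real.rpow_mul (by positivity), Real.mul_rpow (by positivity) hB,
        ← Real.rpow_mul (by positivity),
        show 1 / 2 * (p - 2) * (1 / p) = 1 / 2 - 1 / p by field_simp, Real.mul_rpow hN hB,
        mul_assoc]
    _ = _ := by
      rw [← Real.rpow_add_of_nonneg hB _ (by positivity), sub_add_cancel]
      rw [sub_nonneg]
      exact one_div_le_one_div_of_le two_pos hp

theorem inv_mul_setIntegral_Ico_rescale {L : ℝ} (hL : 0 < L) (l : ℝ) (g : ℝ → ℝ) :
    L⁻¹ * ∫ x in Set.Ico l (l + L), g ((x - l) / L) = ∫ y in (0 : ℝ)..1, g y := by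
  rw [integral_Ico_eq_integral_Ioc, ← intervalIntegral.integral_of_le (by linarith),
    intervalIntegral.integral_comp_sub_right (fun x => g (x / L)) l,
    intervalIntegral.integral_comp_div g hL.ne', smul_eq_mul, inv_mul_cancel_left₀ hL.ne']
  simp [hL.ne']

theorem Tile.wp_of_mem_Iset (t : Tile) {x : ℝ} (hx : x ∈ t.Iset) :
    t.wp x = (√t.len)⁻¹ * walsh t.m ((x - t.left) / t.len) := by
  have hL : 0 < t.len := zpow_pos two_pos _
  have hmem : (x - t.left) / t.len ∈ Set.Ico (0 : ℝ) 1 :=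
    ⟨div_nonneg (sub_nonneg.2 hx.1) hL.le, (div_lt_one hL).2 (by linarith [hx.2])⟩
  rw [Tile.wp, walshChar, if_pos hmem]

/-- **Local Rubio de Francia / span estimate.** Let `I` be a dyadic interval,
`T` a collection of `N` pairwise disjoint tiles `t` with `I_t = I`, and `H_I`
the span of `{w_t : t ∈ T}`. There is an absolute constant `c` such that for
every `2 ≤ p' < ∞` and every `v ∈ H_I`,
`‖v‖_{L^{p'}(I, dx/|I|)} ≤ c N^{1/2 - 1/p'} ‖v‖_{L²(I, dx/|I|)}`. -/
theorem span_Lp_estimate :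
    ∃ c : ℝ, 0 < c ∧
      ∀ (k : ℤ) (n : ℕ) (T : Finset Tile),
        (∀ t ∈ T, t.k = k ∧ t.n = n) →
        ((T : Set Tile).Pairwise fun t t' => Disjoint t.rect t'.rect) →
        ∀ v : ℝ → ℝ, v ∈ Submodule.span ℝ {w : ℝ → ℝ | ∃ t ∈ T, w = t.wp} →
          ∀ p' : ℝ, 2 ≤ p' →
            (((2 : ℝ) ^ k)⁻¹ *
                ∫ x in Set.Ico ((2 : ℝ) ^ k * n) ((2 : ℝ) ^ k * (n + 1)),
                  |v x| ^ p') ^ (1 / p') ≤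
              c * (T.card : ℝ) ^ ((1 : ℝ) / 2 - 1 / p') *
                (((2 : ℝ) ^ k)⁻¹ *
                    ∫ x in Set.Ico ((2 : ℝ) ^ k * n) ((2 : ℝ) ^ k * (n + 1)),
                      (v x) ^ 2) ^ ((1 : ℝ) / 2) := by
  refine ⟨1, one_pos, fun k n T hT _ v hv p hp => ?_⟩
  have hset : {w : ℝ → ℝ | ∃ t ∈ T, w = t.wp} = Tile.wp '' T := by
    ext w
    simp [eq_comm]
  rw [hset, Submodule.mem_span_image_finset_iff_exists_fun'] at hv
  obtain ⟨a, rfl⟩ := hv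
  have hL : (0 : ℝ) < 2 ^ k := zpow_pos two_pos _
  have hinj : Set.InjOn Tile.m (T : Set Tile) := by
    rintro ⟨k₁, n₁, m₁⟩ h₁ ⟨k₂, n₂, m₂⟩ h₂ h
    obtain ⟨rfl, rfl⟩ := hT _ h₁
    obtain ⟨hk, hn⟩ := hT _ h₂
    simp_all
  have hv : ∀ x ∈ Set.Ico ((2 : ℝ) ^ k * n) ((2 : ℝ) ^ k * n + 2 ^ k),
      (∑ t ∈ T, a t • t.wp) x =
        ∑ t ∈ T, a t * (√(2 ^ k))⁻¹ * walsh t.m ((x - 2 ^ k * n) / 2 ^ k) := by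
    intro x hx
    rw [Finset.sum_apply]
    refine Finset.sum_congr rfl fun t ht => ?_
    obtain ⟨rfl, rfl⟩ := hT t ht
    rw [Pi.smul_apply, t.wp_of_mem_Iset hx, smul_eq_mul, mul_assoc]
    rfl
  have hrescale : ∀ F : ℝ → ℝ, ((2 : ℝ) ^ k)⁻¹ *
      ∫ x in Set.Ico ((2 : ℝ) ^ k * n) ((2 : ℝ) ^ k * (n + 1)), F ((∑ t ∈ T, a t • t.wp) x) =
      ∫ y in (0 : ℝ)..1, F (∑ t ∈ T, a t * (√(2 ^ k))⁻¹ * walsh t.m y) := by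
    intro F
    rw [← inv_mul_setIntegral_Ico_rescale hL (2 ^ k * n), mul_add_one]
    congr 1
    exact setIntegral_congr_fun measurableSet_Ico fun x hx => congrArg F (hv x hx)
  rw [hrescale fun z => |z| ^ p, hrescale fun z => z ^ 2, one_mul]
  exact sum_walsh_Lp_estimate T hinj _ hp
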